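/- arXiv:2508.11444 — 2 statements merged into one kernel-verified Lean document; each statement's English description precedes it below -/
import Mathlib

section
/- Every 3-regular 2-edge-connected graph (multigraphs allowed) has a perfect matching (Petersen's theorem). -/
/-- A multigraph: a type of vertices, a type of edges, and an incidence
map sending each edge to its (unordered, possibly equal) pair of
endpoints.  Parallel edges and loops are allowed. -/
structure Multigraph (V E : Type) where
  ends : E → Sym2 V

/-- The multiplicity with which a vertex `v` occurs in an unordered pair
`p`: 2 if `p = {v,v}` (a loop at `v`), 1 if `v` is one of two distinct
elements of `p`, 0 otherwise. -/
def Sym2.multiplicity {V : Type} [DecidableEq V] (v : V) (p : Sym2 V) : ℕ :=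
  if p = Sym2.diag v then 2 else if v ∈ p then 1 else 0

namespace Multigraph

variable {V E : Type} (G : Multigraph V E)

/-- The degree of a vertex, counting loops twice. -/
def degree [DecidableEq V] [Fintype E] (v : V) : ℕ :=
  ∑ e : E, Sym2.multiplicity v (G.ends e)

def Adj (u v : V) : Prop := ∃ e, G.ends e = s(u, v)

def Connected : Prop := Nonempty V ∧ ∀ u v : V, Relation.ReflTransGen G.Adj u v

/-- `e₀` is a bridge: its removal disconnects the graph. -/
def IsBridge (e₀ : E) : Prop :=
  ∃ u v : V, ¬ Relation.ReflTransGen (fun a b => ∃ e, e ≠ e₀ ∧ G.ends e = s(a, b)) u v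

/-- 2-edge-connected: connected and without bridges. -/
def TwoEdgeConnected : Prop := G.Connected ∧ ∀ e, ¬ G.IsBridge e

/-- A perfect matching: every vertex is incident to exactly one edge of
the set. -/
def IsPerfectMatching (M : Set E) : Prop :=
  ∀ v : V, ∃! e : E, e ∈ M ∧ v ∈ G.ends e

end Multigraph

theorem Sym2.multiplicity_mk {V : Type} [DecidableEq V] (v a b : V) :
    Sym2.multiplicity v s(a, b) = (if v = a then 1 else 0) + (if v = b then 1 else 0) := by
  unfold Sym2.multiplicity
  by_cases h1 : v = a <;> by_cases h2 : v = b
  · subst h1; subst h2; simp [Sym2.diag]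
  · subst h1; simp [Sym2.diag, h2, Ne.symm h2]
  · subst h2; simp [Sym2.diag, h1, Ne.symm h1]
  · simp [Sym2.diag, h1, h2, Ne.symm h1]

theorem Sym2.sum_multiplicity_mk {V : Type} [DecidableEq V] (S : Finset V) (a b : V) :
    ∑ v ∈ S, Sym2.multiplicity v s(a, b)
      = (if a ∈ S then 1 else 0) + (if b ∈ S then 1 else 0) := by
  simp [Sym2.multiplicity_mk, Finset.sum_add_distrib]

namespace Multigraph

variable {V E : Type} (G : Multigraph V E)

/-- The edge `e` crosses the cut defined by `S`. -/
def Crosses (S : Finset V) (e : E) : Prop :=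
  ∃ a b, a ∈ S ∧ b ∉ S ∧ G.ends e = s(a, b)

theorem sum_mult_eq [DecidableEq V] [Fintype E] (hreg : ∀ v, G.degree v = 3) (S : Finset V) :
    ∑ e : E, ∑ v ∈ S, Sym2.multiplicity v (G.ends e) = 3 * S.card := by
  rw [Finset.sum_comm]
  have : ∀ v ∈ S, ∑ e : E, Sym2.multiplicity v (G.ends e) = 3 := fun v _ => hreg v
  rw [Finset.sum_congr rfl this]
  simp [mul_comm]

open Classical in
theorem sum_mult_mod [DecidableEq V] (S : Finset V) (e : E) :
    (∑ v ∈ S, Sym2.multiplicity v (G.ends e)) % 2 = (if G.Crosses S e then 1 else 0) % 2 := by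
  obtain ⟨a, b, h⟩ : ∃ a b, G.ends e = s(a, b) := by
    induction h : G.ends e with
    | _ a b => exact ⟨a, b, rfl⟩
  have hc : G.Crosses S e ↔ (a ∈ S ∧ b ∉ S) ∨ (b ∈ S ∧ a ∉ S) := by
    constructor
    · rintro ⟨c, d, hc, hd, h'⟩
      rw [h, Sym2.eq_iff] at h'
      rcases h' with ⟨rfl, rfl⟩ | ⟨rfl, rfl⟩
      · exact Or.inl ⟨hc, hd⟩
      · exact Or.inr ⟨hc, hd⟩
    · rintro (⟨h1, h2⟩ | ⟨h1, h2⟩)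
      · exact ⟨a, b, h1, h2, h⟩
      · exact ⟨b, a, h1, h2, h.trans Sym2.eq_swap⟩
  rw [h, Sym2.sum_multiplicity_mk]
  by_cases ha : a ∈ S <;> by_cases hb : b ∈ S <;> simp [hc, ha, hb]

open Classical in
theorem three_le_cut [DecidableEq V] [Fintype E] (hreg : ∀ v, G.degree v = 3)
    (h2ec : G.TwoEdgeConnected) (S : Finset V) (hS : Odd S.card) :
    3 ≤ (Finset.univ.filter (fun e => G.Crosses S e)).card := by
  have h1 := G.sum_mult_eq hreg S
  have h2 : (Finset.univ.filter (fun e => G.Crosses S e)).card % 2 = (3 * S.card) % 2 := by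
    rw [← h1, Finset.card_filter, Finset.sum_nat_mod, Finset.sum_nat_mod (n := 2)
      (f := fun e => ∑ v ∈ S, Sym2.multiplicity v (G.ends e))]
    simp only [G.sum_mult_mod S]
  have h3 : (Finset.univ.filter (fun e => G.Crosses S e)).card ≠ 1 := by
    intro h
    obtain ⟨e₀, he₀⟩ := Finset.card_eq_one.mp h
    have hiff : ∀ e, G.Crosses S e ↔ e = e₀ := by
      intro e
      have : e ∈ Finset.univ.filter (fun e => G.Crosses S e) ↔ e ∈ ({e₀} : Finset E) := by
        rw [he₀]
      simpa using this
    obtain ⟨a, b, ha, hb, hab⟩ := (hiff e₀).2 rfl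
    refine h2ec.2 e₀ ⟨a, b, fun hr => hb ?_⟩
    clear hb hab
    induction hr with
    | refl => exact ha
    | tail _ hstep ih =>
      obtain ⟨e, hne, he⟩ := hstep
      by_contra hcon
      exact hne ((hiff e).1 ⟨_, _, ih, hcon, he⟩)
  obtain ⟨k, hk⟩ := hS
  omega

/-- The underlying simple graph. -/
def toSimple : SimpleGraph V where
  Adj u v := u ≠ v ∧ G.Adj u v
  symm := ⟨fun u v ⟨h, e, he⟩ => ⟨h.symm, e, he.trans Sym2.eq_swap⟩⟩
  loopless := ⟨fun u h => h.1 rfl⟩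

theorem exists_of_simple (M : G.toSimple.Subgraph) (hM : M.IsPerfectMatching) :
    ∃ M : Set E, G.IsPerfectMatching M := by
  have hex : ∀ x : M.edgeSet, ∃ e, G.ends e = x.1 := by
    rintro ⟨x, hx⟩
    induction x with
    | _ a b =>
      have := M.adj_sub (SimpleGraph.Subgraph.mem_edgeSet.1 hx)
      exact this.2
  choose f hf using hex
  refine ⟨Set.range f, fun v => ?_⟩
  obtain ⟨w, hw, huniq⟩ := SimpleGraph.Subgraph.isPerfectMatching_iff.1 hM v
  refine ⟨f ⟨s(v, w), SimpleGraph.Subgraph.mem_edgeSet.2 hw⟩, ⟨⟨_, rfl⟩, ?_⟩, ?_⟩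
  · rw [hf]; simp
  · rintro e ⟨⟨⟨x, hx⟩, rfl⟩, hv⟩
    rw [hf] at hv
    obtain ⟨y, rfl⟩ := Sym2.mem_iff_exists.1 hv
    have := huniq y (SimpleGraph.Subgraph.mem_edgeSet.1 hx)
    subst this
    rfl

open Classical in
theorem not_violator [Fintype V] [DecidableEq V] [Fintype E] (hreg : ∀ v, G.degree v = 3)
    (h2ec : G.TwoEdgeConnected) (u : Set V) : ¬ G.toSimple.IsTutteViolator u := by
  unfold SimpleGraph.IsTutteViolator
  rw [not_lt]
  set K := ((⊤ : G.toSimple.Subgraph).deleteVerts u).coe with hK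
  let S : K.ConnectedComponent → Finset V := fun C => (Subtype.val '' C.supp).toFinset
  have hSmem : ∀ C a, a ∈ S C ↔ ∃ x ∈ C.supp, x.1 = a := by
    intro C a; simp [S]
  have hSu : ∀ C a, a ∈ S C → a ∉ u := by
    intro C a ha
    obtain ⟨x, _, rfl⟩ := (hSmem C a).1 ha
    exact x.2.2
  have hdisj : ∀ C D a, a ∈ S C → a ∈ S D → C = D := by
    intro C D a hC hD
    obtain ⟨x, hx, rfl⟩ := (hSmem C a).1 hC
    obtain ⟨y, hy, hxy⟩ := (hSmem D _).1 hD
    obtain rfl := Subtype.ext hxy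
    rw [SimpleGraph.ConnectedComponent.mem_supp_iff] at hx hy
    exact hx.symm.trans hy
  have hout : ∀ C a b e, a ∈ S C → b ∉ S C → G.ends e = s(a, b) → b ∈ u := by
    intro C a b e ha hb he
    by_contra hbu
    apply hb
    obtain ⟨x, hx, rfl⟩ := (hSmem C a).1 ha
    have hb' : b ∈ ((⊤ : G.toSimple.Subgraph).deleteVerts u).verts := by simp [hbu]
    refine (hSmem C b).2 ⟨⟨b, hb'⟩, ?_, rfl⟩
    have hne : x.1 ≠ b := by
      rintro rfl; exact hb ha
    have hadj : K.Adj x ⟨b, hb'⟩ := by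
      have hxu : x.1 ∉ u := x.2.2
      have : G.toSimple.Adj x.1 b := ⟨hne, e, he⟩
      simp [hK, SimpleGraph.Subgraph.deleteVerts_adj, hxu, hbu, this]
    exact C.mem_supp_of_adj_mem_supp hx hadj
  have hodd : ∀ C ∈ K.oddComponents, Odd (S C).card := by
    intro C hC
    have h : Odd C.supp.ncard := hC
    have : (S C).card = C.supp.ncard := by
      rw [← Set.ncard_eq_toFinset_card', Set.ncard_image_of_injective _ Subtype.val_injective]
    rwa [this]
  rw [Set.ncard_eq_toFinset_card' K.oddComponents, Set.ncard_eq_toFinset_card' u]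
  have h1 := G.sum_mult_eq hreg u.toFinset
  have h2 : ∑ C ∈ K.oddComponents.toFinset, 3 ≤
      ∑ C ∈ K.oddComponents.toFinset, ∑ e : E, if G.Crosses (S C) e then 1 else 0 := by
    refine Finset.sum_le_sum fun C hC => ?_
    have := G.three_le_cut hreg h2ec (S C) (hodd C (by simpa using hC))
    rwa [Finset.card_filter] at this
  rw [Finset.sum_comm] at h2
  have h3 : ∀ e : E, (∑ C ∈ K.oddComponents.toFinset, if G.Crosses (S C) e then 1 else 0)
      ≤ ∑ v ∈ u.toFinset, Sym2.multiplicity v (G.ends e) := by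
    intro e
    by_cases hex : ∃ C, G.Crosses (S C) e
    · obtain ⟨C, a, b, ha, hb, he⟩ := hex
      have hbu := hout C a b e ha hb he
      rw [he, Sym2.sum_multiplicity_mk, ← Finset.card_filter]
      have hle : (K.oddComponents.toFinset.filter (fun C => G.Crosses (S C) e)).card ≤ 1 := by
        have hall : ∀ D, G.Crosses (S D) e → D = C := by
          rintro D ⟨c, d, hc, hd, he'⟩
          rw [he, Sym2.eq_iff] at he'
          rcases he' with ⟨rfl, rfl⟩ | ⟨rfl, rfl⟩
          · exact hdisj _ _ _ hc ha
          · exact absurd hbu (hSu _ _ hc)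
        refine Finset.card_le_one.2 fun D hD D' hD' => ?_
        rw [hall D (Finset.mem_filter.1 hD).2, hall D' (Finset.mem_filter.1 hD').2]
      have : b ∈ u.toFinset := by simpa using hbu
      rw [if_pos this]
      omega
    · push Not at hex
      simp [hex]
  have h4 := h2.trans (Finset.sum_le_sum fun e _ => h3 e)
  rw [h1] at h4
  simp only [Finset.sum_const, smul_eq_mul] at h4
  omega

end Multigraph

/-- Petersen's theorem: every 3-regular 2-edge-connected
multigraph has a perfect matching. -/
theorem petersen {V E : Type} [Fintype V] [Fintype E] [DecidableEq V]
    (G : Multigraph V E) (hreg : ∀ v, G.degree v = 3)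
    (h2ec : G.TwoEdgeConnected) :
    ∃ M : Set E, G.IsPerfectMatching M := by
  obtain ⟨M, hM⟩ := SimpleGraph.tutte.2 (G.not_violator hreg h2ec)
  exact G.exists_of_simple M hM
end

section
/- In a 3-regular 2-edge-connected graph, for every edge e there exists a perfect matching containing e. -/
namespace PetersenAux

open Finset Multigraph

variable {V E : Type} [Fintype V] [Fintype E] [DecidableEq V]

/-- Number of ends of `p` in `C`, with multiplicity. -/
def inc (C : Finset V) (p : Sym2 V) : ℕ := ∑ v ∈ C, Sym2.multiplicity v p

theorem inc_mk (C : Finset V) (x y : V) :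
    inc C s(x, y) = (if x ∈ C then 1 else 0) + (if y ∈ C then 1 else 0) := by
  have h : ∀ v, Sym2.multiplicity v s(x, y) =
      (if x = v then 1 else 0) + (if y = v then 1 else 0) := by
    intro v
    unfold Sym2.multiplicity
    by_cases h1 : x = v <;> by_cases h2 : y = v <;>
      simp [Sym2.diag, h1, h2, eq_comm]
  unfold inc
  simp only [h, sum_add_distrib, Finset.sum_ite_eq]

theorem sum_inc (G : Multigraph V E) (hreg : ∀ v, G.degree v = 3) (C : Finset V) :
    ∑ e, inc C (G.ends e) = 3 * #C := by
  unfold inc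
  rw [sum_comm]
  have : ∀ v ∈ C, ∑ e, Sym2.multiplicity v (G.ends e) = 3 := fun v _ => hreg v
  rw [sum_congr rfl this]
  simp [mul_comm]

theorem inc_le (C : Finset V) (p : Sym2 V) : inc C p ≤ 2 := by
  induction p with | _ x y
  rw [inc_mk]; split_ifs <;> simp

/-- Indicator of boundary edges. -/
def bd (C : Finset V) (p : Sym2 V) : ℕ := if inc C p = 1 then 1 else 0

theorem three_le_bd (G : Multigraph V E) (hreg : ∀ v, G.degree v = 3)
    (hbr : ∀ e, ¬ G.IsBridge e) (C : Finset V) (hC : Odd #C) :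
    3 ≤ ∑ e, bd C (G.ends e) := by
  have hodd : (∑ e, bd C (G.ends e)) % 2 = 1 := by
    have h1 := sum_inc G hreg C
    have h2 : (∑ e, bd C (G.ends e)) % 2 = (∑ e, inc C (G.ends e)) % 2 := by
      rw [Finset.sum_nat_mod, Finset.sum_nat_mod univ 2 (fun e => inc C (G.ends e))]
      congr 1
      refine sum_congr rfl fun e _ => ?_
      have := inc_le C (G.ends e)
      unfold bd
      split_ifs <;> omega
    rw [h2, h1]
    rcases hC with ⟨k, hk⟩
    omega
  have hne : ∑ e, bd C (G.ends e) ≠ 1 := by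
    intro h
    have hc : #{e | inc C (G.ends e) = 1} = 1 := by
      rw [card_filter]; exact h
    obtain ⟨e, he⟩ := card_eq_one.1 hc
    have he1 : ∀ f, inc C (G.ends f) = 1 ↔ f = e := by
      intro f
      have := congrArg (f ∈ ·) he
      simpa using this
    apply hbr e
    have key : ∀ x y, x ∈ C → y ∉ C → G.IsBridge e := by
      intro x y hx hy
      refine ⟨x, y, fun hr => hy ?_⟩
      clear hy
      induction hr with
      | refl => exact hx
      | tail _ hstep ih =>
        obtain ⟨f, hf, hends⟩ := hstep
        by_contra hn
        apply hf
        rw [← he1, hends, inc_mk]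
        simp [ih, hn]
    have h1 := (he1 e).2 rfl
    obtain ⟨x, y, hxy⟩ : ∃ x y, G.ends e = s(x, y) := by
      induction G.ends e with | _ x y
      exact ⟨x, y, rfl⟩
    rw [hxy, inc_mk] at h1
    by_cases hx : x ∈ C <;> by_cases hy : y ∈ C <;> simp [hx, hy] at h1
    · exact key x y hx hy
    · exact key y x hy hx
  omega

theorem no_loop (G : Multigraph V E) (hreg : ∀ v, G.degree v = 3)
    (hbr : ∀ e, ¬ G.IsBridge e) (e : E) (a b : V) (h : G.ends e = s(a, b)) : a ≠ b := by
  classical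
  rintro rfl
  have h1 := sum_inc G hreg {a}
  have h2 := three_le_bd G hreg hbr {a} (by simp)
  have h3 : ∑ e, bd {a} (G.ends e) < ∑ e, inc {a} (G.ends e) := by
    apply sum_lt_sum
    · intro f _
      unfold bd; split_ifs <;> omega
    · refine ⟨e, mem_univ _, ?_⟩
      rw [h]; simp [bd, inc_mk]
  simp at h1
  omega

theorem even_card (G : Multigraph V E) (hreg : ∀ v, G.degree v = 3) :
    Even (Fintype.card V) := by
  have h1 := sum_inc G hreg univ
  have h2 : ∀ e, inc univ (G.ends e) = 2 := by
    intro e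
    induction G.ends e with | _ x y
    simp [inc_mk]
  simp only [h2] at h1
  simp at h1
  rw [Nat.even_iff]; omega

/-- Tutte's theorem in finset form. -/
theorem tutte' {W : Type} [Fintype W] [DecidableEq W] (H : SimpleGraph W)
    (h : ¬ ∃ M : H.Subgraph, M.IsPerfectMatching) :
    ∃ (S : Finset W) (D : Finset (Finset W)), #S < #D ∧
      (Odd #D ↔ Odd (#(Sᶜ))) ∧ (∀ C ∈ D, Odd #C) ∧ (∀ C ∈ D, Disjoint C S) ∧
      (∀ C ∈ D, ∀ x ∈ C, ∀ y, H.Adj x y → y ∈ C ∨ y ∈ S) ∧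
      (∀ C ∈ D, ∀ C' ∈ D, ∀ x ∈ C, x ∈ C' → C = C') := by
  classical
  rw [SimpleGraph.tutte] at h
  push Not at h
  obtain ⟨u, hu⟩ := h
  unfold SimpleGraph.IsTutteViolator at hu
  set K := ((⊤ : H.Subgraph).deleteVerts u).coe with hK
  let φ : K.ConnectedComponent → Finset W :=
    fun c => (c.supp.toFinset).map (Function.Embedding.subtype _)
  have hmem : ∀ c x, x ∈ φ c ↔ ∃ hx, K.connectedComponentMk ⟨x, hx⟩ = c := by
    intro c x
    simp [φ]
  have hinj : ∀ c c' x, x ∈ φ c → x ∈ φ c' → c = c' := by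
    intro c c' x hx hx'
    rw [hmem] at hx hx'
    obtain ⟨_, h1⟩ := hx
    obtain ⟨_, h2⟩ := hx'
    rw [← h1, ← h2]
  have hne : ∀ c, (φ c).Nonempty := by
    intro c
    obtain ⟨x, hx⟩ := c.nonempty_supp
    exact ⟨x.1, (hmem _ _).2 ⟨x.2, hx⟩⟩
  have hφ : Function.Injective φ := by
    intro c c' hcc
    obtain ⟨x, hx⟩ := hne c
    exact hinj c c' x hx (hcc ▸ hx)
  have hcard : #(K.oddComponents.toFinset.image φ) = K.oddComponents.ncard := by
    rw [card_image_of_injective _ hφ, Set.ncard_eq_toFinset_card']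
  refine ⟨u.toFinset, K.oddComponents.toFinset.image φ, ?_, ?_, ?_, ?_, ?_, ?_⟩
  · rw [hcard, ← Set.ncard_eq_toFinset_card']
    exact hu
  · rw [hcard, SimpleGraph.odd_ncard_oddComponents]
    rw [← Set.toFinset_compl, ← Set.ncard_eq_toFinset_card', ← Nat.card_coe_set_eq]
    have : ((⊤ : H.Subgraph).deleteVerts u).verts = uᶜ := by
      ext; simp
    rw [this]
  · intro C hC
    obtain ⟨c, hc, rfl⟩ := mem_image.1 hC
    have : Odd c.supp.ncard := by simpa using hc
    simp only [φ, card_map]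
    rwa [← Set.ncard_eq_toFinset_card']
  · intro C hC
    obtain ⟨c, hc, rfl⟩ := mem_image.1 hC
    rw [Finset.disjoint_left]
    intro x hx
    obtain ⟨h1, _⟩ := (hmem _ _).1 hx
    simpa using h1
  · intro C hC x hx y hxy
    obtain ⟨c, hc, rfl⟩ := mem_image.1 hC
    by_cases hy : y ∈ u
    · right; simpa using hy
    left
    obtain ⟨h1, h2⟩ := (hmem _ _).1 hx
    refine (hmem _ _).2 ⟨by simpa using hy, ?_⟩
    rw [← h2]
    apply SimpleGraph.ConnectedComponent.sound
    apply SimpleGraph.Adj.reachable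
    have h3 : x ∉ u := by simpa using h1
    simp [hK, h3, hy, hxy.symm]
  · intro C hC C' hC' x hx hx'
    obtain ⟨c, hc, rfl⟩ := mem_image.1 hC
    obtain ⟨c', hc', rfl⟩ := mem_image.1 hC'
    have hcc := hinj c c' x hx hx'
    exact congrArg φ hcc

/-- The underlying simple graph on the complement of two vertices. -/
def H (G : Multigraph V E) (a b : V) : SimpleGraph {v : V // v ≠ a ∧ v ≠ b} where
  Adj u w := u ≠ w ∧ ∃ e, G.ends e = s(u.1, w.1)
  symm := ⟨fun u w ⟨h, e, he⟩ => ⟨h.symm, e, by rw [he, Sym2.eq_swap]⟩⟩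
  loopless := ⟨fun _ h => h.1 rfl⟩

/-- The counting step. -/
theorem count (G : Multigraph V E) (hreg : ∀ v, G.degree v = 3)
    (hbr : ∀ e, ¬ G.IsBridge e) (e₀ : E) (S : Finset V) (hS : inc S (G.ends e₀) = 2)
    (D : Finset (Finset V)) (hodd : ∀ C ∈ D, Odd #C) (hdisj : ∀ C ∈ D, Disjoint C S)
    (hcl : ∀ C ∈ D, ∀ x ∈ C, ∀ y, (∃ e, G.ends e = s(x, y)) → y ∈ C ∨ y ∈ S)
    (huniq : ∀ C ∈ D, ∀ C' ∈ D, ∀ x ∈ C, x ∈ C' → C = C') : #D < #S := by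
  have h1 : #D * 3 ≤ ∑ C ∈ D, ∑ e, bd C (G.ends e) := by
    rw [← smul_eq_mul]
    exact card_nsmul_le_sum _ _ _ fun C hC => three_le_bd G hreg hbr C (hodd C hC)
  rw [sum_comm] at h1
  have h2 := sum_inc G hreg S
  -- a boundary edge has exactly one end in S
  have hb : ∀ e, ∀ C ∈ D, inc C (G.ends e) = 1 →
      ∃ x y, G.ends e = s(x, y) ∧ x ∈ C ∧ y ∈ S := by
    intro e C hC h
    obtain ⟨x, y, hxy⟩ : ∃ x y, G.ends e = s(x, y) := by
      induction G.ends e with | _ x y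
      exact ⟨x, y, rfl⟩
    rw [hxy, inc_mk] at h
    by_cases hx : x ∈ C <;> by_cases hy : y ∈ C <;> simp [hx, hy] at h
    · exact ⟨x, y, hxy, hx, (hcl C hC x hx y ⟨e, hxy⟩).resolve_left hy⟩
    · have hyx : G.ends e = s(y, x) := by rw [hxy, Sym2.eq_swap]
      exact ⟨y, x, hyx, hy, (hcl C hC y hy x ⟨e, hyx⟩).resolve_left hx⟩
  have hnS : ∀ C ∈ D, ∀ x ∈ C, x ∉ S := fun C hC x hx =>
    Finset.disjoint_left.1 (hdisj C hC) hx
  have h3 : ∑ e, ∑ C ∈ D, bd C (G.ends e) < ∑ e, inc S (G.ends e) := by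
    have hz : ∀ e, inc S (G.ends e) ≠ 1 → ∑ C ∈ D, bd C (G.ends e) = 0 := by
      intro e he
      refine sum_eq_zero fun C hC => ?_
      unfold bd
      rw [if_neg]
      intro h
      obtain ⟨x, y, hxy, hx, hy⟩ := hb e C hC h
      apply he
      rw [hxy, inc_mk]
      simp [hnS C hC x hx, hy]
    apply sum_lt_sum
    · intro e _
      by_cases he : inc S (G.ends e) = 1
      · rw [he]
        unfold bd
        rw [← card_filter, card_le_one]
        intro C hC C' hC'
        rw [mem_filter] at hC hC'
        obtain ⟨x, y, hxy, hx, hy⟩ := hb e C hC.1 hC.2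
        obtain ⟨x', y', hxy', hx', hy'⟩ := hb e C' hC'.1 hC'.2
        have hxx : x = x' := by
          rw [hxy, Sym2.eq_iff] at hxy'
          rcases hxy' with h | h
          · exact h.1
          · exact absurd (h.1 ▸ hy') (hnS C hC.1 x hx)
        subst hxx
        exact huniq C hC.1 C' hC'.1 x hx hx'
      · rw [hz e he]; exact Nat.zero_le _
    · refine ⟨e₀, mem_univ _, ?_⟩
      rw [hz e₀ (by omega), hS]; norm_num
  omega

theorem exists_matching (G : Multigraph V E) (hreg : ∀ v, G.degree v = 3)
    (hbr : ∀ e, ¬ G.IsBridge e) (e₀ : E) (a b : V) (h0 : G.ends e₀ = s(a, b)) :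
    ∃ M : (H G a b).Subgraph, M.IsPerfectMatching := by
  classical
  have hab := no_loop G hreg hbr e₀ a b h0
  by_contra hM
  obtain ⟨S, D, hlt, hpar, hodd, hdisj, hcl, huniq⟩ := tutte' _ hM
  let ι : {v : V // v ≠ a ∧ v ≠ b} ↪ V := Function.Embedding.subtype _
  have hι : ∀ (C : Finset {v : V // v ≠ a ∧ v ≠ b}) x,
      x ∈ C.map ι ↔ ∃ hx, (⟨x, hx⟩ : {v : V // v ≠ a ∧ v ≠ b}) ∈ C := by
    intro C x; simp [ι]
  have hcS : #(insert a (insert b (S.map ι))) = #S + 2 := by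
    rw [card_insert_of_notMem, card_insert_of_notMem, card_map]
    · rw [hι]; rintro ⟨h, _⟩; exact h.2 rfl
    · rw [mem_insert, hι]
      rintro (h | ⟨h, _⟩)
      · exact hab h
      · exact h.1 rfl
  have hcount := count G hreg hbr e₀ (insert a (insert b (S.map ι)))
    (by rw [h0, inc_mk]; simp) (D.map ⟨fun C => C.map ι, Finset.map_injective ι⟩)
    (by
      simp only [mem_map, Function.Embedding.coeFn_mk]
      rintro _ ⟨C, hC, rfl⟩
      rw [card_map]; exact hodd C hC)
    (by
      simp only [mem_map, Function.Embedding.coeFn_mk]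
      rintro _ ⟨C, hC, rfl⟩
      rw [Finset.disjoint_left]
      intro x hx
      obtain ⟨h1, h2⟩ := (hι _ _).1 hx
      rw [mem_insert, mem_insert, hι]
      rintro (h | h | ⟨h, h'⟩)
      · exact h1.1 h
      · exact h1.2 h
      · exact Finset.disjoint_left.1 (hdisj C hC) h2 h')
    (by
      simp only [mem_map, Function.Embedding.coeFn_mk]
      rintro _ ⟨C, hC, rfl⟩ x hx y ⟨e, he⟩
      obtain ⟨h1, h2⟩ := (hι _ _).1 hx
      have hxy := no_loop G hreg hbr e x y he
      rw [mem_insert, mem_insert, hι, hι]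
      by_cases hya : y = a
      · simp [hya]
      by_cases hyb : y = b
      · simp [hyb]
      rcases hcl C hC _ h2 ⟨y, hya, hyb⟩ ⟨fun h => hxy (congrArg Subtype.val h), e, he⟩ with h | h
      · exact Or.inl ⟨_, h⟩
      · exact Or.inr (Or.inr (Or.inr ⟨_, h⟩)))
    (by
      simp only [mem_map, Function.Embedding.coeFn_mk]
      rintro _ ⟨C, hC, rfl⟩ _ ⟨C', hC', rfl⟩ x hx hx'
      obtain ⟨h1, h2⟩ := (hι _ _).1 hx
      obtain ⟨h1', h2'⟩ := (hι _ _).1 hx'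
      rw [huniq C hC C' hC' _ h2 h2'])
  rw [card_map, hcS] at hcount
  have hW : Fintype.card {v : V // v ≠ a ∧ v ≠ b} + 2 = Fintype.card V := by
    have h1 : #(insert a (insert b ((univ : Finset {v : V // v ≠ a ∧ v ≠ b}).map ι))) =
        Fintype.card {v : V // v ≠ a ∧ v ≠ b} + 2 := by
      rw [card_insert_of_notMem, card_insert_of_notMem, card_map, card_univ]
      · rw [hι]; rintro ⟨h, _⟩; exact h.2 rfl
      · rw [mem_insert, hι]
        rintro (h | ⟨h, _⟩)
        · exact hab h
        · exact h.1 rfl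
    rw [← h1, ← card_univ]
    congr 1
    ext x
    rw [mem_insert, mem_insert, hι]
    simp
    tauto
  have hev := even_card G hreg
  have hcc := card_add_card_compl S
  rw [Nat.odd_iff, Nat.odd_iff] at hpar
  rw [Nat.even_iff] at hev
  omega

end PetersenAux

/-- In a 3-regular 2-edge-connected multigraph, every edge
lies in some perfect matching. -/
theorem petersen_through_edge {V E : Type} [Fintype V] [Fintype E] [DecidableEq V]
    (G : Multigraph V E) (hreg : ∀ v, G.degree v = 3)
    (h2ec : G.TwoEdgeConnected) :
    ∀ e₀ : E, ∃ M : Set E, G.IsPerfectMatching M ∧ e₀ ∈ M := by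
  classical
  intro e₀
  obtain ⟨a, b, h0⟩ : ∃ x y, G.ends e₀ = s(x, y) := by
    induction G.ends e₀ with | _ x y
    exact ⟨x, y, rfl⟩
  obtain ⟨M, hM⟩ := PetersenAux.exists_matching G hreg h2ec.2 e₀ a b h0
  rw [SimpleGraph.Subgraph.isPerfectMatching_iff] at hM
  let f : Sym2 V → E := fun p => if h : ∃ e, G.ends e = p then h.choose else e₀
  have hf : ∀ u w, M.Adj u w → G.ends (f s(u.1, w.1)) = s(u.1, w.1) := by
    intro u w h
    have h1 : ∃ e, G.ends e = s(u.1, w.1) := (M.adj_sub h).2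
    simp only [f, dif_pos h1]
    exact h1.choose_spec
  refine ⟨{e | e = e₀ ∨ ∃ u w, M.Adj u w ∧ e = f s(u.1, w.1)}, ?_, Or.inl rfl⟩
  intro v
  by_cases hv : v ≠ a ∧ v ≠ b
  · obtain ⟨w, hw, hwu⟩ := hM ⟨v, hv⟩
    refine ⟨f s(v, w.1), ⟨Or.inr ⟨_, _, hw, rfl⟩, ?_⟩, ?_⟩
    · rw [hf _ _ hw]; simp
    · rintro e ⟨rfl | ⟨u, w', huw, rfl⟩, hve⟩
      · rw [h0, Sym2.mem_iff] at hve
        tauto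
      · rw [hf _ _ huw, Sym2.mem_iff] at hve
        rcases hve with h | h
        · subst h
          rw [hwu w' huw]
        · subst h
          rw [hwu u huw.symm, Sym2.eq_swap]
  · refine ⟨e₀, ⟨Or.inl rfl, ?_⟩, ?_⟩
    · rw [h0, Sym2.mem_iff]; tauto
    · rintro e ⟨rfl | ⟨u, w', huw, rfl⟩, hve⟩
      · rfl
      · rw [hf _ _ huw, Sym2.mem_iff] at hve
        rcases hve with h | h
        · exact absurd (h ▸ u.2) hv
        · exact absurd (h ▸ w'.2) hv
end
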